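/- Let (A, ·, { , , }, ⦃ , , ⦄) be an associative-Yamaguti algebra and (M, ·, { , , }, ⦃ , , ⦄) a representation of it. Define ρ : A → End(M) and ν : A × A → End(M) by ρ(a)u := a·u − u·a and ν(a,b)u := {u,a,b} − {a,u,b} − ⦃b,u,a⦄ + ⦃b,a,u⦄. Then (M, ρ, ν) is a representation of the Lie-Yamaguti algebra (A, [ , ], ⟦ , , ⟧), where [a,b] := a·b − b·a and ⟦a,b,c⟧ := {a,b,c} − {b,a,c} − ⦃c,a,b⦄ + ⦃c,b,a⦄; that is, with D(x,y) := [ρ(x),ρ(y)] − ρ([x,y]) − ν(x,y) + ν(y,x), for all x,y,z,w ∈ A: ν([x,y],z) − ν(x,z)ρ(y) + ν(y,z)ρ(x) = 0; ν(x,[y,z]) − ρ(y)ν(x,z) + ρ(z)ν(x,y) = 0; ρ(⟦x,y,z⟧) = D(x,y)ρ(z) − ρ(z)D(x,y); ν(z,w)ν(x,y) − ν(y,w)ν(x,z) − ν(x,⟦y,z,w⟧) + D(y,z)ν(x,w) = 0; and ν(⟦x,y,z⟧,w) + ν(z,⟦x,y,w⟧) = D(x,y)ν(z,w) − ν(z,w)D(x,y).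 -/

import Mathlib

set_option maxHeartbeats 1000000

/-- An associative-Yamaguti algebra structure: a bilinear multiplication `mul` and
trilinear operations `tri` (`{ , , }`) and `tri'` (`⦃ , , ⦄`) satisfying (AY1)-(AY11). -/
structure IsAssYamaguti {k A : Type*} [Field k] [AddCommGroup A] [Module k A]
    (mul : A →ₗ[k] A →ₗ[k] A) (tri tri' : A →ₗ[k] A →ₗ[k] A →ₗ[k] A) : Prop where
  ay1 : ∀ a b c : A, mul (mul a b) c - mul a (mul b c) + tri a b c - tri' a b c = 0
  ay2 : ∀ a b c d : A, tri (mul a b) c d = tri a (mul b c) d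
  ay3 : ∀ a b c d : A, tri a b (mul c d) = mul (tri a b c) d
  ay4 : ∀ a b c d : A, tri' (mul a b) c d = mul a (tri' b c d)
  ay5 : ∀ a b c d : A, tri' a (mul b c) d = tri' a b (mul c d)
  ay6 : ∀ a b c d : A, mul a (tri b c d) = mul (tri' a b c) d
  ay7a : ∀ a b c d e : A, tri (tri a b c) d e = tri a (tri' b c d) e
  ay7b : ∀ a b c d e : A, tri a (tri' b c d) e = tri a b (tri c d e)
  ay8 : ∀ a b c d e : A, tri a (tri b c d) e = tri (tri' a b c) d e
  ay9a : ∀ a b c d e : A, tri' (tri' a b c) d e = tri' a (tri b c d) e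
  ay9b : ∀ a b c d e : A, tri' a (tri b c d) e = tri' a b (tri' c d e)
  ay10 : ∀ a b c d e : A, tri' a (tri' b c d) e = tri' a b (tri c d e)
  ay11 : ∀ a b c d e : A, tri a b (tri' c d e) = tri' (tri a b c) d e

/-- A representation of an associative-Yamaguti algebra `(A, mul, tri, tri')` on `M`:
actions `al : A × M → M` (`a·u`), `ar : M × A → M` (`u·a`) and trilinear actions
`t0,t1,t2` (for `{ , , }` with the `M`-slot in position 1,2,3) and `s0,s1,s2`
(for `⦃ , , ⦄`), satisfying the identities (AY1)-(AY11) whenever exactly one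
argument lies in `M` and the remaining arguments lie in `A`. -/
structure IsAssYRep {k A M : Type*} [Field k] [AddCommGroup A] [Module k A]
    [AddCommGroup M] [Module k M]
    (mul : A →ₗ[k] A →ₗ[k] A) (tri tri' : A →ₗ[k] A →ₗ[k] A →ₗ[k] A)
    (al : A →ₗ[k] M →ₗ[k] M) (ar : M →ₗ[k] A →ₗ[k] M)
    (t0 : M →ₗ[k] A →ₗ[k] A →ₗ[k] M) (t1 : A →ₗ[k] M →ₗ[k] A →ₗ[k] M)
    (t2 : A →ₗ[k] A →ₗ[k] M →ₗ[k] M)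
    (s0 : M →ₗ[k] A →ₗ[k] A →ₗ[k] M) (s1 : A →ₗ[k] M →ₗ[k] A →ₗ[k] M)
    (s2 : A →ₗ[k] A →ₗ[k] M →ₗ[k] M) : Prop where
  ay1a : ∀ (u : M) (b c : A), ar (ar u b) c - ar u (mul b c) + t0 u b c - s0 u b c = 0
  ay1b : ∀ (a : A) (v : M) (c : A), ar (al a v) c - al a (ar v c) + t1 a v c - s1 a v c = 0
  ay1c : ∀ (a b : A) (w : M), al (mul a b) w - al a (al b w) + t2 a b w - s2 a b w = 0
  ay2a : ∀ (u : M) (b c d : A), t0 (ar u b) c d = t0 u (mul b c) d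
  ay2b : ∀ (a : A) (v : M) (c d : A), t0 (al a v) c d = t1 a (ar v c) d
  ay2c : ∀ (a b : A) (w : M) (d : A), t1 (mul a b) w d = t1 a (al b w) d
  ay2d : ∀ (a b c : A) (x : M), t2 (mul a b) c x = t2 a (mul b c) x
  ay3a : ∀ (u : M) (b c d : A), t0 u b (mul c d) = ar (t0 u b c) d
  ay3b : ∀ (a : A) (v : M) (c d : A), t1 a v (mul c d) = ar (t1 a v c) d
  ay3c : ∀ (a b : A) (w : M) (d : A), t2 a b (ar w d) = ar (t2 a b w) d
  ay3d : ∀ (a b c : A) (x : M), t2 a b (al c x) = al (tri a b c) x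
  ay4a : ∀ (u : M) (b c d : A), s0 (ar u b) c d = ar u (tri' b c d)
  ay4b : ∀ (a : A) (v : M) (c d : A), s0 (al a v) c d = al a (s0 v c d)
  ay4c : ∀ (a b : A) (w : M) (d : A), s1 (mul a b) w d = al a (s1 b w d)
  ay4d : ∀ (a b c : A) (x : M), s2 (mul a b) c x = al a (s2 b c x)
  ay5a : ∀ (u : M) (b c d : A), s0 u (mul b c) d = s0 u b (mul c d)
  ay5b : ∀ (a : A) (v : M) (c d : A), s1 a (ar v c) d = s1 a v (mul c d)
  ay5c : ∀ (a b : A) (w : M) (d : A), s1 a (al b w) d = s2 a b (ar w d)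
  ay5d : ∀ (a b c : A) (x : M), s2 a (mul b c) x = s2 a b (al c x)
  ay6a : ∀ (u : M) (b c d : A), ar u (tri b c d) = ar (s0 u b c) d
  ay6b : ∀ (a : A) (v : M) (c d : A), al a (t0 v c d) = ar (s1 a v c) d
  ay6c : ∀ (a b : A) (w : M) (d : A), al a (t1 b w d) = ar (s2 a b w) d
  ay6d : ∀ (a b c : A) (x : M), al a (t2 b c x) = al (tri' a b c) x
  ay7a1 : ∀ (u : M) (b c d e : A), t0 (t0 u b c) d e = t0 u (tri' b c d) e
  ay7a2 : ∀ (u : M) (b c d e : A), t0 u (tri' b c d) e = t0 u b (tri c d e)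
  ay7b1 : ∀ (a : A) (v : M) (c d e : A), t0 (t1 a v c) d e = t1 a (s0 v c d) e
  ay7b2 : ∀ (a : A) (v : M) (c d e : A), t1 a (s0 v c d) e = t1 a v (tri c d e)
  ay7c1 : ∀ (a b : A) (w : M) (d e : A), t0 (t2 a b w) d e = t1 a (s1 b w d) e
  ay7c2 : ∀ (a b : A) (w : M) (d e : A), t1 a (s1 b w d) e = t2 a b (t0 w d e)
  ay7d1 : ∀ (a b c : A) (x : M) (e : A), t1 (tri a b c) x e = t1 a (s2 b c x) e
  ay7d2 : ∀ (a b c : A) (x : M) (e : A), t1 a (s2 b c x) e = t2 a b (t1 c x e)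
  ay7e1 : ∀ (a b c d : A) (y : M), t2 (tri a b c) d y = t2 a (tri' b c d) y
  ay7e2 : ∀ (a b c d : A) (y : M), t2 a (tri' b c d) y = t2 a b (t2 c d y)
  ay8a : ∀ (u : M) (b c d e : A), t0 u (tri b c d) e = t0 (s0 u b c) d e
  ay8b : ∀ (a : A) (v : M) (c d e : A), t1 a (t0 v c d) e = t0 (s1 a v c) d e
  ay8c : ∀ (a b : A) (w : M) (d e : A), t1 a (t1 b w d) e = t0 (s2 a b w) d e
  ay8d : ∀ (a b c : A) (x : M) (e : A), t1 a (t2 b c x) e = t1 (tri' a b c) x e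
  ay8e : ∀ (a b c d : A) (y : M), t2 a (tri b c d) y = t2 (tri' a b c) d y
  ay9a1 : ∀ (u : M) (b c d e : A), s0 (s0 u b c) d e = s0 u (tri b c d) e
  ay9a2 : ∀ (u : M) (b c d e : A), s0 u (tri b c d) e = s0 u b (tri' c d e)
  ay9b1 : ∀ (a : A) (v : M) (c d e : A), s0 (s1 a v c) d e = s1 a (t0 v c d) e
  ay9b2 : ∀ (a : A) (v : M) (c d e : A), s1 a (t0 v c d) e = s1 a v (tri' c d e)
  ay9c1 : ∀ (a b : A) (w : M) (d e : A), s0 (s2 a b w) d e = s1 a (t1 b w d) e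
  ay9c2 : ∀ (a b : A) (w : M) (d e : A), s1 a (t1 b w d) e = s2 a b (s0 w d e)
  ay9d1 : ∀ (a b c : A) (x : M) (e : A), s1 (tri' a b c) x e = s1 a (t2 b c x) e
  ay9d2 : ∀ (a b c : A) (x : M) (e : A), s1 a (t2 b c x) e = s2 a b (s1 c x e)
  ay9e1 : ∀ (a b c d : A) (y : M), s2 (tri' a b c) d y = s2 a (tri b c d) y
  ay9e2 : ∀ (a b c d : A) (y : M), s2 a (tri b c d) y = s2 a b (s2 c d y)
  ay10a : ∀ (u : M) (b c d e : A), s0 u (tri' b c d) e = s0 u b (tri c d e)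
  ay10b : ∀ (a : A) (v : M) (c d e : A), s1 a (s0 v c d) e = s1 a v (tri c d e)
  ay10c : ∀ (a b : A) (w : M) (d e : A), s1 a (s1 b w d) e = s2 a b (t0 w d e)
  ay10d : ∀ (a b c : A) (x : M) (e : A), s1 a (s2 b c x) e = s2 a b (t1 c x e)
  ay10e : ∀ (a b c d : A) (y : M), s2 a (tri' b c d) y = s2 a b (t2 c d y)
  ay11a : ∀ (u : M) (b c d e : A), t0 u b (tri' c d e) = s0 (t0 u b c) d e
  ay11b : ∀ (a : A) (v : M) (c d e : A), t1 a v (tri' c d e) = s0 (t1 a v c) d e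
  ay11c : ∀ (a b : A) (w : M) (d e : A), t2 a b (s0 w d e) = s0 (t2 a b w) d e
  ay11d : ∀ (a b c : A) (x : M) (e : A), t2 a b (s1 c x e) = s1 (tri a b c) x e
  ay11e : ∀ (a b c d : A) (y : M), t2 a b (s2 c d y) = s2 (tri a b c) d y

variable {k A M : Type*} [Field k] [AddCommGroup A] [Module k A]
  [AddCommGroup M] [Module k M]

/-- `ρ(a)u := a·u - u·a`. -/
def rhoMap (al : A →ₗ[k] M →ₗ[k] M) (ar : M →ₗ[k] A →ₗ[k] M) (a : A) (u : M) : M :=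
  al a u - ar u a

/-- `ν(a,b)u := {u,a,b} - {a,u,b} - ⦃b,u,a⦄ + ⦃b,a,u⦄`. -/
def nuMap (t0 : M →ₗ[k] A →ₗ[k] A →ₗ[k] M) (t1 s1 : A →ₗ[k] M →ₗ[k] A →ₗ[k] M)
    (s2 : A →ₗ[k] A →ₗ[k] M →ₗ[k] M) (a b : A) (u : M) : M :=
  t0 u a b - t1 a u b - s1 b u a + s2 b a u

/-- `[a,b] := a·b - b·a`. -/
def lyBr (mul : A →ₗ[k] A →ₗ[k] A) (a b : A) : A := mul a b - mul b a

/-- `⟦a,b,c⟧ := {a,b,c} - {b,a,c} - ⦃c,a,b⦄ + ⦃c,b,a⦄`. -/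
def lyTri (tri tri' : A →ₗ[k] A →ₗ[k] A →ₗ[k] A) (a b c : A) : A :=
  tri a b c - tri b a c - tri' c a b + tri' c b a

/-- `D(x,y) := [ρ(x),ρ(y)] - ρ([x,y]) - ν(x,y) + ν(y,x)`. -/
def dMap (mul : A →ₗ[k] A →ₗ[k] A) (al : A →ₗ[k] M →ₗ[k] M) (ar : M →ₗ[k] A →ₗ[k] M)
    (t0 : M →ₗ[k] A →ₗ[k] A →ₗ[k] M) (t1 s1 : A →ₗ[k] M →ₗ[k] A →ₗ[k] M)
    (s2 : A →ₗ[k] A →ₗ[k] M →ₗ[k] M) (x y : A) (u : M) : M :=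
  rhoMap al ar x (rhoMap al ar y u) - rhoMap al ar y (rhoMap al ar x u)
    - rhoMap al ar (lyBr mul x y) u - nuMap t0 t1 s1 s2 x y u + nuMap t0 t1 s1 s2 y x u

/-- `D(x,y)u = {x,y,u} - {y,x,u} + ⦃u,y,x⦄ - ⦃u,x,y⦄`, the representation analogue of `lyTri`. -/
theorem IsAssYRep.dMap_eq
    {mul : A →ₗ[k] A →ₗ[k] A} {tri tri' : A →ₗ[k] A →ₗ[k] A →ₗ[k] A}
    {al : A →ₗ[k] M →ₗ[k] M} {ar : M →ₗ[k] A →ₗ[k] M}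
    {t0 : M →ₗ[k] A →ₗ[k] A →ₗ[k] M} {t1 : A →ₗ[k] M →ₗ[k] A →ₗ[k] M}
    {t2 : A →ₗ[k] A →ₗ[k] M →ₗ[k] M}
    {s0 : M →ₗ[k] A →ₗ[k] A →ₗ[k] M} {s1 : A →ₗ[k] M →ₗ[k] A →ₗ[k] M}
    {s2 : A →ₗ[k] A →ₗ[k] M →ₗ[k] M}
    (hM : IsAssYRep mul tri tri' al ar t0 t1 t2 s0 s1 s2) (x y : A) (u : M) :
    dMap mul al ar t0 t1 s1 s2 x y u = t2 x y u - t2 y x u + s0 u y x - s0 u x y := by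
  simp only [dMap, rhoMap, nuMap, lyBr, map_sub, LinearMap.sub_apply]
  linear_combination (norm := abel) hM.ay1a u y x - hM.ay1a u x y + hM.ay1b x u y - hM.ay1b y u x
    - hM.ay1c x y u + hM.ay1c y x u

/-- a representation of an associative-Yamaguti algebra yields a
representation `(M, ρ, ν)` of the associated Lie-Yamaguti algebra. -/
theorem assY_rep_to_lieY_rep [CharZero k]
    (mul : A →ₗ[k] A →ₗ[k] A) (tri tri' : A →ₗ[k] A →ₗ[k] A →ₗ[k] A)
    (al : A →ₗ[k] M →ₗ[k] M) (ar : M →ₗ[k] A →ₗ[k] M)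
    (t0 : M →ₗ[k] A →ₗ[k] A →ₗ[k] M) (t1 : A →ₗ[k] M →ₗ[k] A →ₗ[k] M)
    (t2 : A →ₗ[k] A →ₗ[k] M →ₗ[k] M)
    (s0 : M →ₗ[k] A →ₗ[k] A →ₗ[k] M) (s1 : A →ₗ[k] M →ₗ[k] A →ₗ[k] M)
    (s2 : A →ₗ[k] A →ₗ[k] M →ₗ[k] M)
    (hA : IsAssYamaguti mul tri tri')
    (hM : IsAssYRep mul tri tri' al ar t0 t1 t2 s0 s1 s2) :
    (∀ (x y z : A) (u : M),
      nuMap t0 t1 s1 s2 (lyBr mul x y) z u - nuMap t0 t1 s1 s2 x z (rhoMap al ar y u)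
        + nuMap t0 t1 s1 s2 y z (rhoMap al ar x u) = 0) ∧
    (∀ (x y z : A) (u : M),
      nuMap t0 t1 s1 s2 x (lyBr mul y z) u - rhoMap al ar y (nuMap t0 t1 s1 s2 x z u)
        + rhoMap al ar z (nuMap t0 t1 s1 s2 x y u) = 0) ∧
    (∀ (x y z : A) (u : M),
      rhoMap al ar (lyTri tri tri' x y z) u =
        dMap mul al ar t0 t1 s1 s2 x y (rhoMap al ar z u)
          - rhoMap al ar z (dMap mul al ar t0 t1 s1 s2 x y u)) ∧
    (∀ (x y z w : A) (u : M),
      nuMap t0 t1 s1 s2 z w (nuMap t0 t1 s1 s2 x y u)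
        - nuMap t0 t1 s1 s2 y w (nuMap t0 t1 s1 s2 x z u)
        - nuMap t0 t1 s1 s2 x (lyTri tri tri' y z w) u
        + dMap mul al ar t0 t1 s1 s2 y z (nuMap t0 t1 s1 s2 x w u) = 0) ∧
    (∀ (x y z w : A) (u : M),
      nuMap t0 t1 s1 s2 (lyTri tri tri' x y z) w u
        + nuMap t0 t1 s1 s2 z (lyTri tri tri' x y w) u =
        dMap mul al ar t0 t1 s1 s2 x y (nuMap t0 t1 s1 s2 z w u)
          - nuMap t0 t1 s1 s2 z w (dMap mul al ar t0 t1 s1 s2 x y u)) := by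
  refine ⟨fun x y z u => ?_, fun x y z u => ?_, fun x y z u => ?_, fun x y z w u => ?_,
    fun x y z w u => ?_⟩
  · simp only [nuMap, rhoMap, lyBr, map_sub, LinearMap.sub_apply]
    simp only [hM.ay2a, hM.ay2b, hM.ay2c, hM.ay5b, hM.ay5c, hM.ay5d]
    abel
  · simp only [nuMap, rhoMap, lyBr, map_sub, map_add, LinearMap.sub_apply, LinearMap.add_apply]
    simp only [hM.ay3a, hM.ay3b, hM.ay4c, hM.ay4d, hM.ay6b, hM.ay6c]
    abel
  · simp only [rhoMap, lyTri, hM.dMap_eq, map_sub, map_add, LinearMap.sub_apply,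
      LinearMap.add_apply]
    simp only [hM.ay3c, hM.ay3d, hM.ay4a, hM.ay4b, hM.ay6a, hM.ay6d]
    abel
  · simp only [nuMap, lyTri, hM.dMap_eq, map_sub, map_add, LinearMap.sub_apply, LinearMap.add_apply]
    simp only [hM.ay7a1, hM.ay7a2, ← hM.ay11a, hM.ay7b1, hM.ay7b2, hM.ay8b, hM.ay9b1, hM.ay9b2,
      ← hM.ay11b, hM.ay7c2, hM.ay8c, hM.ay9c1, hM.ay9c2, hM.ay10c, hM.ay7d2, hM.ay9d1, hM.ay9d2,
      hM.ay10d, ← hM.ay11d, hM.ay9e1, hM.ay9e2, ← hM.ay11e]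
    abel
  · simp only [nuMap, lyTri, hM.dMap_eq, map_sub, map_add, LinearMap.sub_apply, LinearMap.add_apply]
    simp only [hM.ay7a2, hM.ay8a, ← hM.ay11a, hM.ay7b2, hM.ay9b1, hM.ay9b2, hM.ay10b, ← hM.ay11b,
      hM.ay7c1, hM.ay7c2, hM.ay9c1, hM.ay9c2, hM.ay7d1, hM.ay7d2, hM.ay8d, hM.ay9d1, hM.ay9d2,
      ← hM.ay11d, hM.ay9e1, hM.ay9e2, hM.ay10e, ← hM.ay11e]
    abel
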